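/- Let k ∈ {1,2,3}, let G be a finite k-edge-connected undirected graph with destination t ∈ V, and let T_1,…,T_k be pairwise arc-disjoint arborescences of G rooted at t. Then for every cyclic order of {T_1,…,T_k} and every choice of starting arborescence, the circular-arborescence routing process is (k−1)-resilient against dynamic failures. -/

import Mathlib

namespace FRR

open scoped Classical

variable {V : Type*} [Fintype V] [DecidableEq V]

/-- `G` is `k`-edge-connected: removing any set of at most `k-1` edges keeps it connected. -/
def EdgeConnected (G : SimpleGraph V) (k : ℕ) : Prop :=
  ∀ F : Set (Sym2 V), F ⊆ G.edgeSet → F.ncard ≤ k - 1 → (G.deleteEdges F).Connected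

/-- An arborescence of `G` rooted at `t`, given by a parent map: every node `v ≠ t`
has exactly one outgoing arc `(v, par v)`, and iterating the parent map reaches `t`. -/
structure Arb (G : SimpleGraph V) (t : V) where
  par : V → V
  adj : ∀ v, v ≠ t → G.Adj v (par v)
  reaches : ∀ v, ∃ n : ℕ, par^[n] v = t

/-- The arc `(u, v)` belongs to the arborescence `T`. -/
def Arb.Arc {G : SimpleGraph V} {t : V} (T : Arb G t) (u v : V) : Prop :=
  u ≠ t ∧ T.par u = v

/-- Two arborescences are arc-disjoint: they share no directed arc. -/
def ArcDisjoint {G : SimpleGraph V} {t : V} (T T' : Arb G t) : Prop :=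
  ∀ u v : V, ¬ (T.Arc u v ∧ T'.Arc u v)

/-- One step of the circular-arborescence routing process on the cyclic order
`⟨T 0, …, T (m-1)⟩` at time `n`: route canonically along the current arborescence;
if the outgoing arc is down, switch to the first arborescence after the current one
in the cyclic order whose outgoing arc at the current node is up. -/
noncomputable def circNext {G : SimpleGraph V} {t : V} {m : ℕ}
    (T : Fin m → Arb G t) (σ : ℕ → Set (Sym2 V)) (n : ℕ)
    (v : V) (i : Fin m) : V × Fin m :=
  if v = t then (v, i)
  else if s(v, (T i).par v) ∉ σ n then ((T i).par v, i)
  else if h : ∃ d : ℕ, d < m ∧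
      s(v, (T ⟨((i : ℕ) + 1 + d) % m, Nat.mod_lt _ i.pos⟩).par v) ∉ σ n then
    let j : Fin m := ⟨((i : ℕ) + 1 + Nat.find h) % m, Nat.mod_lt _ i.pos⟩
    ((T j).par v, j)
  else (v, i)

/-- The trajectory of the circular-arborescence routing process started at node `s`
on arborescence `i₀`, under the failure schedule `σ`. -/
noncomputable def circTraj {G : SimpleGraph V} {t : V} {m : ℕ}
    (T : Fin m → Arb G t) (σ : ℕ → Set (Sym2 V)) (s : V) (i₀ : Fin m) :
    ℕ → V × Fin m
  | 0 => (s, i₀)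
  | n + 1 => circNext T σ n (circTraj T σ s i₀ n).1 (circTraj T σ s i₀ n).2

/-- The circular-arborescence routing process on `T` is `r`-resilient against dynamic
failures: for every unstable-link set `F` with `|F| ≤ r`, every (dynamic, i.e. arbitrary)
failure schedule `σ` on `F`, every starting node `s` and starting arborescence `i₀`,
if the trajectory satisfies the non-trap assumption and `s` is connected to `t`
in `G ∖ F`, then the packet reaches `t` after finitely many steps. -/
def CircResilient {G : SimpleGraph V} (t : V) {m : ℕ} (T : Fin m → Arb G t)
    (r : ℕ) : Prop :=
  ∀ F : Set (Sym2 V), F ⊆ G.edgeSet → F.ncard ≤ r →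
    ∀ σ : ℕ → Set (Sym2 V), (∀ n, σ n ⊆ F) →
      ∀ (s : V) (i₀ : Fin m),
        (∀ n, (G.deleteEdges F).Reachable (circTraj T σ s i₀ n).1
            (circTraj T σ s i₀ (n + 1)).1) →
        (G.deleteEdges F).Reachable s t →
        ∃ n, (circTraj T σ s i₀ n).1 = t

/-- The index `d` places after `i` in the cyclic order. -/
def idx {m : ℕ} (i : Fin m) (d : ℕ) : Fin m := ⟨((i : ℕ) + d) % m, Nat.mod_lt _ i.pos⟩

lemma idx_zero {m : ℕ} (i : Fin m) : idx i 0 = i := by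
  apply Fin.ext
  simp [idx, Nat.mod_eq_of_lt i.isLt]

lemma idx_idx {m : ℕ} (i : Fin m) (a b : ℕ) : idx (idx i a) b = idx i (a + b) := by
  apply Fin.ext
  simp [idx, Nat.add_assoc]

lemma idx_surj {m : ℕ} (i j : Fin m) : ∃ d, d < m ∧ idx i d = j := by
  refine ⟨((j : ℕ) + (m - i)) % m, Nat.mod_lt _ i.pos, ?_⟩
  apply Fin.ext
  have hi := i.isLt
  have : (i : ℕ) + ((j : ℕ) + (m - i)) = j + m := by omega
  simp [idx, this, Nat.mod_eq_of_lt j.isLt]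

lemma circNext_eq {G : SimpleGraph V} {t : V} {m : ℕ}
    (T : Fin m → Arb G t) (σ : ℕ → Set (Sym2 V)) (n : ℕ)
    (v : V) (i : Fin m) (hv : v ≠ t) (d : ℕ) (hd : d < m)
    (hup : s(v, (T (idx i d)).par v) ∉ σ n)
    (hmin : ∀ d' < d, s(v, (T (idx i d')).par v) ∈ σ n) :
    circNext T σ n v i = ((T (idx i d)).par v, idx i d) := by
  unfold circNext
  rw [if_neg hv]
  rcases d with _ | d
  · rw [idx_zero] at *
    rw [if_pos hup]
  · have h0 := hmin 0 (by omega)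
    rw [idx_zero] at h0
    rw [if_neg (by simpa using h0)]
    have e : ∀ d, (⟨((i : ℕ) + 1 + d) % m, Nat.mod_lt _ i.pos⟩ : Fin m) = idx i (d + 1) := by
      intro d
      apply Fin.ext
      simp only [idx]
      congr 1
      omega
    have hex : ∃ d : ℕ, d < m ∧
      s(v, (T ⟨((i : ℕ) + 1 + d) % m, Nat.mod_lt _ i.pos⟩).par v) ∉ σ n :=
      ⟨d, by omega, by rw [e]; exact hup⟩
    rw [dif_pos hex]
    have hf : Nat.find hex = d := by
      rw [Nat.find_eq_iff]
      refine ⟨⟨by omega, by rw [e]; exact hup⟩, ?_⟩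
      intro k hk hh
      rw [e] at hh
      exact hh.2 (hmin (k + 1) (by omega))
    simp only [hf]
    rw [e]

lemma circNext_skip {G : SimpleGraph V} {t : V} {m : ℕ}
    (T : Fin m → Arb G t) (σ : ℕ → Set (Sym2 V)) (n : ℕ)
    (v : V) (i : Fin m) (hv : v ≠ t)
    (hex : ∃ j, s(v, (T j).par v) ∉ σ n)
    (hdown : s(v, (T i).par v) ∈ σ n) :
    circNext T σ n v i = circNext T σ n v (idx i 1) := by
  have h : ∃ d, d < m ∧ s(v, (T (idx i d)).par v) ∉ σ n := by
    obtain ⟨j, hj⟩ := hex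
    obtain ⟨d, hd, rfl⟩ := idx_surj i j
    exact ⟨d, hd, hj⟩
  have hs := Nat.find_spec h
  have hm : ∀ d' < Nat.find h, s(v, (T (idx i d')).par v) ∈ σ n := by
    intro d' hd'
    have := Nat.find_min h hd'
    by_contra hc
    exact this ⟨by omega, hc⟩
  generalize Nat.find h = d at hs hm
  rcases d with _ | d
  · rw [idx_zero] at hs
    exact absurd hdown hs.2
  · rw [circNext_eq T σ n v i hv (d + 1) hs.1 hs.2 hm,
      circNext_eq T σ n v (idx i 1) hv d (by omega)
        (by rw [idx_idx, Nat.add_comm]; exact hs.2)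
        (by
          intro d' hd'
          rw [idx_idx, Nat.add_comm]
          exact hm (d' + 1) (by omega)),
      idx_idx, Nat.add_comm 1 d]

/-- At time `n` the packet is at `u` and behaves as if it were on arborescence `i`. -/
def Virt {G : SimpleGraph V} {t : V} {m : ℕ}
    (T : Fin m → Arb G t) (σ : ℕ → Set (Sym2 V)) (s : V) (i₀ : Fin m)
    (n : ℕ) (u : V) (i : Fin m) : Prop :=
  (circTraj T σ s i₀ n).1 = u ∧ circTraj T σ s i₀ (n + 1) = circNext T σ n u i

lemma virt_hit {G : SimpleGraph V} {t : V} {m : ℕ}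
    (T : Fin m → Arb G t) (σ : ℕ → Set (Sym2 V)) (s : V) (i₀ : Fin m)
    (hnt : ∀ n, (circTraj T σ s i₀ n).1 ≠ t) (i : Fin m) (N : ℕ) :
    ∀ n u, (T i).par^[N] u = t → Virt T σ s i₀ n u i →
      ∃ n' a, Virt T σ s i₀ n' ((T i).par^[a] u) i ∧
        s((T i).par^[a] u, (T i).par ((T i).par^[a] u)) ∈ σ n' ∧
        ∀ b ≤ a, (T i).par^[b] u ≠ t := by
  induction N with
  | zero =>
    intro n u h hv
    exact absurd (hv.1.trans h) (hnt n)
  | succ N ih =>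
    intro n u h hv
    have hut : u ≠ t := fun h => hnt n (hv.1.trans h)
    by_cases hd : s(u, (T i).par u) ∈ σ n
    · refine ⟨n, 0, hv, hd, ?_⟩
      intro b hb
      obtain rfl : b = 0 := by omega
      exact hut
    · have hstep : circTraj T σ s i₀ (n + 1) = ((T i).par u, i) := by
        rw [hv.2, circNext, if_neg hut, if_pos hd]
      obtain ⟨n', a, h1, h2, h3⟩ := ih (n + 1) ((T i).par u)
        (by simpa using h)
        ⟨by rw [hstep], by rw [circTraj, hstep]⟩
      refine ⟨n', a + 1, by simpa using h1, by simpa using h2, ?_⟩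
      intro b hb
      rcases b with _ | b
      · exact hut
      · simpa using h3 b (by omega)

lemma no_cycle {G : SimpleGraph V} {t : V} (T : Arb G t) (u : V) (a : ℕ)
    (h : ∀ b ≤ a, T.par^[b] u ≠ t) (hc : T.par (T.par^[a] u) = u) : False := by
  obtain ⟨N, hN⟩ := T.reaches u
  have hp : Function.IsPeriodicPt T.par (a + 1) u := by
    change T.par^[a + 1] u = u
    rw [Function.iterate_succ_apply']
    exact hc
  have := hp.iterate_mod_apply N
  exact h (N % (a + 1)) (by have := Nat.mod_lt N (show 0 < a + 1 by omega); omega) (this.trans hN)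

/-- After a hit at `u` on arborescence `i`, the next hit is on the next arborescence
and on a different link. -/
lemma next_hit {G : SimpleGraph V} {t : V} {m : ℕ}
    (T : Fin m → Arb G t) (hdisj : ∀ i j, i ≠ j → ArcDisjoint (T i) (T j))
    (F : Set (Sym2 V)) (hF : F.ncard < m)
    (σ : ℕ → Set (Sym2 V)) (hσ : ∀ n, σ n ⊆ F) (s : V) (i₀ : Fin m)
    (hnt : ∀ n, (circTraj T σ s i₀ n).1 ≠ t) (hm : 2 ≤ m) (i : Fin m) (n : ℕ) (u : V)
    (hv : Virt T σ s i₀ n u i) (hd : s(u, (T i).par u) ∈ σ n) :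
    ∃ n' u', Virt T σ s i₀ n' u' (idx i 1) ∧ s(u', (T (idx i 1)).par u') ∈ σ n' ∧
      u' ≠ t ∧ s(u', (T (idx i 1)).par u') ≠ s(u, (T i).par u) := by
  have hut : u ≠ t := fun h => hnt n (hv.1.trans h)
  have hex : ∃ j, s(u, (T j).par u) ∉ σ n := by
    by_contra hc
    push Not at hc
    have hinj : Function.Injective (fun j => s(u, (T j).par u)) := by
      intro j j' hjj
      by_contra hne
      exact hdisj j j' hne u _ ⟨⟨hut, rfl⟩, hut, (Sym2.congr_right.1 hjj).symm⟩
    have hsub : Set.range (fun j => s(u, (T j).par u)) ⊆ F := by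
      rintro _ ⟨j, rfl⟩
      exact hσ n (hc j)
    have h1 := Set.ncard_le_ncard hsub (Set.toFinite F)
    have h2 : (Set.range (fun j => s(u, (T j).par u))).ncard = m := by
      rw [← Set.image_univ, Set.ncard_image_of_injective _ hinj, Set.ncard_univ, Nat.card_fin]
    omega
  have hv' : Virt T σ s i₀ n u (idx i 1) :=
    ⟨hv.1, hv.2.trans (circNext_skip T σ n u i hut hex hd)⟩
  obtain ⟨N, hN⟩ := (T (idx i 1)).reaches u
  obtain ⟨n', a, h1, h2, h3⟩ := virt_hit T σ s i₀ hnt (idx i 1) N n u hN hv'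
  refine ⟨n', _, h1, h2, h3 a le_rfl, ?_⟩
  intro he
  rcases Sym2.eq_iff.1 he with ⟨e1, e2⟩ | ⟨e1, e2⟩
  · have hne : idx i 1 ≠ i := by
      intro h
      have h' := congrArg Fin.val h
      have hi := i.isLt
      simp only [idx] at h'
      rcases Nat.lt_or_ge ((i : ℕ) + 1) m with hlt | hge
      · rw [Nat.mod_eq_of_lt hlt] at h'
        omega
      · have : (i : ℕ) + 1 = m := by omega
        rw [this, Nat.mod_self] at h'
        omega
    rw [e1] at e2
    exact hdisj _ _ hne u _ ⟨⟨hut, e2⟩, hut, rfl⟩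
  · exact no_cycle _ u a h3 e2

lemma arc_ne {G : SimpleGraph V} {t : V} {m : ℕ}
    (T : Fin m → Arb G t) (hdisj : ∀ i j, i ≠ j → ArcDisjoint (T i) (T j))
    {i j : Fin m} (hij : i ≠ j) {u w : V} (hu : u ≠ t)
    (he : s(u, (T i).par u) = s(w, (T j).par w)) :
    u = (T j).par w ∧ (T i).par u = w := by
  rcases Sym2.eq_iff.1 he with ⟨e1, e2⟩ | h
  · subst e1
    exact (hdisj i j hij u _ ⟨⟨hu, rfl⟩, hu, e2.symm⟩).elim
  · exact h

lemma eq_of_two {F : Set (Sym2 V)} (hF : F.ncard ≤ 2) {a b c : Sym2 V}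
    (ha : a ∈ F) (hb : b ∈ F) (hc : c ∈ F) (hab : b ≠ a) (hbc : c ≠ b) : c = a := by
  by_contra hne
  have : 2 < F.ncard := by
    rw [Set.two_lt_ncard_iff (Set.toFinite F)]
    exact ⟨a, b, c, ha, hb, hc, hab.symm, fun h => hne h.symm, hbc.symm⟩
  omega

/-- Theorem 1 (k ≤ 3): in a `k`-edge-connected graph with `k ∈ {1,2,3}`, any
circular-arborescence routing (any cyclic order of the `k` arc-disjoint arborescences,
any starting arborescence) is `(k-1)`-resilient against dynamic failures. -/
theorem circular_routing_resilient_k_le_three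
    (G : SimpleGraph V) (t : V) (k : ℕ) (hk : k = 1 ∨ k = 2 ∨ k = 3)
    (hconn : EdgeConnected G k)
    (T : Fin k → Arb G t)
    (hdisj : ∀ i j : Fin k, i ≠ j → ArcDisjoint (T i) (T j))
    (ρ : Equiv.Perm (Fin k)) :
    CircResilient t (fun i => T (ρ i)) (k - 1) := by
  have hdisj' : ∀ i j : Fin k, i ≠ j → ArcDisjoint (T (ρ i)) (T (ρ j)) :=
    fun i j hij => hdisj _ _ (fun h => hij (ρ.injective h))
  generalize hS : (fun i => T (ρ i)) = S
  have hdS : ∀ i j : Fin k, i ≠ j → ArcDisjoint (S i) (S j) := by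
    subst hS
    exact hdisj'
  intro F _ hF σ hσ s i₀ _ _
  by_contra hc
  push Not at hc
  have hkpos : 0 < k := by omega
  obtain ⟨N, hN⟩ := (S i₀).reaches s
  obtain ⟨n0, a, v0, d0, z0⟩ := virt_hit S σ s i₀ hc i₀ N 0 s hN ⟨rfl, rfl⟩
  have t0 := z0 a le_rfl
  generalize (S i₀).par^[a] s = u0 at v0 d0 t0
  have m0 := hσ _ d0
  have hFpos : 0 < F.ncard := (Set.ncard_pos (Set.toFinite F)).2 ⟨_, m0⟩
  have hk2 : 2 ≤ k := by omega
  have nh := next_hit S hdS F (by omega) σ hσ s i₀ hc hk2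
  obtain ⟨n1, u1, v1, d1, t1, ne1⟩ := nh _ _ _ v0 d0
  obtain ⟨n2, u2, v2, d2, t2, ne2⟩ := nh _ _ _ v1 d1
  obtain ⟨n3, u3, v3, d3, t3, ne3⟩ := nh _ _ _ v2 d2
  obtain ⟨n4, u4, v4, d4, t4, ne4⟩ := nh _ _ _ v3 d3
  have m1 := hσ _ d1
  have m2 := hσ _ d2
  have m3 := hσ _ d3
  have m4 := hσ _ d4
  have e20 := eq_of_two (by omega) m0 m1 m2 ne1 ne2
  have e42 := eq_of_two (by omega) m2 m3 m4 ne3 ne4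
  have hk3 : k = 3 := by
    rcases hk with h | h | h
    · omega
    · exfalso
      have : F.ncard ≤ 1 := by omega
      exact ne1 ((Set.ncard_le_one (Set.toFinite F)).1 this _ m1 _ m0)
    · exact h
  subst hk3
  simp only [idx_idx] at e20 e42
  have q1 : idx i₀ (1 + 1) ≠ i₀ := by
    revert i₀; intro i₀; fin_cases i₀ <;> simp [idx]
  have q2 : idx i₀ (1 + (1 + (1 + 1))) ≠ idx i₀ (1 + 1) := by
    fin_cases i₀ <;> simp [idx]
  have q3 : idx i₀ (1 + (1 + (1 + 1))) ≠ i₀ := by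
    fin_cases i₀ <;> simp [idx]
  have r1 := arc_ne S hdS q1 t2 e20
  have r2 := arc_ne S hdS q2 t4 e42
  have r3 := arc_ne S hdS q3 t4 (e42.trans e20)
  have : u0 = u2 := r3.2.symm.trans r2.2
  have hadj := (S i₀).adj u0 t0
  rw [← r1.1, ← this] at hadj
  exact G.irrefl hadj

end FRR
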